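/- Assume (B2). Consider triples consisting of (a) a family of probability measures on (E,𝓔) indexed by Ω, (b) a (0,∞)-valued measurable function on Ω×E, and (c) a measurable function on Ω. The triple (η,h,λ) given by Proposition 2 is the unique such triple satisfying, for all ω ∈ Ω and x ∈ E: η^ωQ^ω(·) = λ_ω·η^{zω}(·), Q^ω(h(zω,·))(x) = λ_ω·h(ω,x), and η^ω(h(ω,·)) = 1. -/

import Mathlib

open MeasureTheory ENNReal Filter Topology

noncomputable section

/-- The environment space `Ω = H^ℤ`. -/
abbrev Env (H : Type*) := ℤ → H

/-- The shift operator `z`: `(zω)(n) = ω(n+1)`. -/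
def shift {H : Type*} (ω : Env H) : Env H := fun n => ω (n + 1)

/-- The inverse shift `z⁻¹`: `(z⁻¹ω)(n) = ω(n-1)`. -/
def shiftInv {H : Type*} (ω : Env H) : Env H := fun n => ω (n - 1)

/-- Iterates `z^{-k}` of the inverse shift. -/
def zitInv {H : Type*} : ℕ → Env H → Env H
  | 0, ω => ω
  | n + 1, ω => shiftInv (zitInv n ω)

variable {H E : Type*} [MeasurableSpace H] [MeasurableSpace E]

/-- Iterates `z^k` of the shift. -/
def zit {H : Type*} : ℕ → Env H → Env H
  | 0, ω => ω
  | n + 1, ω => shift (zit n ω)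

/-- The sub-Markov kernel `Q^ω(x,dx') = W(ω,x) M^ω(x,dx')`. -/
def Qk (M : Env H → E → Measure E) (W : Env H → E → ℝ) (ω : Env H) (x : E) :
    Measure E := ENNReal.ofReal (W ω x) • M ω x

/-- The compositions `Q_n^ω = Q^ω Q^{zω} ⋯ Q^{z^{n-1}ω}` (with `Q_0` the identity). -/
def Qn (M : Env H → E → Measure E) (W : Env H → E → ℝ) :
    ℕ → Env H → E → Measure E
  | 0, _, x => Measure.dirac x
  | n + 1, ω, x => (Qn M W n ω x).bind (Qk M W (zit n ω))

/-- The total mass `σ Q_n^ω(1)`. -/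
def QnMass (M : Env H → E → Measure E) (W : Env H → E → ℝ)
    (n : ℕ) (ω : Env H) (σ : Measure E) : ℝ≥0∞ :=
  (σ.bind (Qn M W n ω)) Set.univ

/-- `Φ_n^ω(σ)(A) = σQ_n^ω(A) / σQ_n^ω(1)`. -/
def PhiSet (M : Env H → E → Measure E) (W : Env H → E → ℝ)
    (n : ℕ) (ω : Env H) (σ : Measure E) (A : Set E) : ℝ≥0∞ :=
  (σ.bind (Qn M W n ω)) A / QnMass M W n ω σ

/-- `Φ_n^ω(σ)(φ)` for a `ℝ≥0∞`-valued function `φ`. -/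
def PhiFun (M : Env H → E → Measure E) (W : Env H → E → ℝ)
    (n : ℕ) (ω : Env H) (σ : Measure E) (φ : E → ℝ≥0∞) : ℝ≥0∞ :=
  (∫⁻ y, φ y ∂(σ.bind (Qn M W n ω))) / QnMass M W n ω σ

/-- The ratio `Q_n^ω(1)(x) / Φ_n^{z^{-n}ω}(σ)(Q_n^ω(1))` whose limit defines `h(ω,x)`. -/
def ratioH (M : Env H → E → Measure E) (W : Env H → E → ℝ) (σ : Measure E)
    (n : ℕ) (ω : Env H) (x : E) : ℝ≥0∞ :=
  (Qn M W n ω x) Set.univ /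
    PhiFun M W n (zitInv n ω) σ (fun y => (Qn M W n ω y) Set.univ)

section Aux

variable {F : Type*} [MeasurableSpace F]

lemma aux_setwise (μ : ℕ → Measure F) (η : Measure F) (hμ : ∀ n, μ n Set.univ ≤ 1)
    (hlim : ∀ A, MeasurableSet A → Tendsto (fun n => μ n A) atTop (𝓝 (η A)))
    (f : F → ℝ) (hf : Measurable f) (h0 : ∀ x, 0 ≤ f x) (C : ℝ) (hC : ∀ x, f x ≤ C) :
    Tendsto (fun n => ∫⁻ x, ENNReal.ofReal (f x) ∂(μ n)) atTop
      (𝓝 (∫⁻ x, ENNReal.ofReal (f x) ∂η)) := by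
  have key : ∀ m : Measure F, ∫⁻ x, ENNReal.ofReal (f x) ∂m
      = ∫⁻ t in Set.Ioi (0:ℝ), m {a | t < f a} := fun m =>
    lintegral_eq_lintegral_meas_lt m (Eventually.of_forall h0) hf.aemeasurable
  simp_rw [key]
  refine tendsto_lintegral_of_dominated_convergence
    (Set.indicator (Set.Iic C) (fun _ => (1:ℝ≥0∞))) ?_ ?_ ?_ ?_
  · intro n
    apply Antitone.measurable
    intro s t hst
    apply measure_mono
    intro a ha
    exact lt_of_le_of_lt hst ha
  · intro n
    refine Eventually.of_forall fun t => ?_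
    by_cases ht : t ≤ C
    · simp only [Set.indicator, Set.mem_Iic, ht, if_true]
      exact (measure_mono (Set.subset_univ _)).trans (hμ n)
    · have : {a | t < f a} = ∅ := by
        ext a
        simp only [Set.mem_ofPred_eq, Set.mem_empty_iff_false, iff_false, not_lt]
        exact (hC a).trans (not_le.mp ht).le
      simp [this]
  · rw [lintegral_indicator measurableSet_Iic]
    simp only [lintegral_const, one_mul]
    rw [Measure.restrict_restrict measurableSet_Iic]
    simp only [MeasurableSet.univ, Measure.restrict_apply, Set.univ_inter]
    rw [Set.inter_comm, Set.Ioi_inter_Iic]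
    simp
  · refine Eventually.of_forall fun t => hlim _ (measurableSet_lt measurable_const hf)

lemma aux_iter (P : ℝ≥0∞ → Prop) (h0 : P 0) (k : ℝ) (hk0 : 0 < k) (hk1 : k ≤ 1)
    (hstep : ∀ c d : ℝ≥0∞, c + d = 1 → P c → P (c + ENNReal.ofReal k * d)) (n : ℕ) :
    P (ENNReal.ofReal (1 - (1 - k) ^ n)) := by
  induction n with
  | zero => simpa using h0
  | succ n ih =>
    have hp0 : 0 ≤ (1 - k) ^ n := pow_nonneg (by linarith) n
    have hp1 : (1 - k) ^ n ≤ 1 := pow_le_one₀ (by linarith) (by linarith)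
    have h1 := hstep _ (ENNReal.ofReal ((1 - k) ^ n)) (by
      rw [← ENNReal.ofReal_add (by linarith) hp0]; simp) ih
    rw [← ENNReal.ofReal_mul hk0.le, ← ENNReal.ofReal_add (by linarith) (by positivity)] at h1
    convert h1 using 2
    ring

lemma aux_iter_lim (k : ℝ) (hk0 : 0 < k) (hk1 : k ≤ 1) :
    Tendsto (fun n : ℕ => ENNReal.ofReal (1 - (1 - k) ^ n)) atTop (𝓝 1) := by
  have := (tendsto_pow_atTop_nhds_zero_of_lt_one (r := 1 - k) (by linarith) (by linarith))
  have := ENNReal.tendsto_ofReal (this.const_sub 1)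
  simpa using this

lemma aux_le_of_iter (P : ℝ≥0∞ → Prop) (h0 : P 0) (k : ℝ) (hk0 : 0 < k) (hk1 : k ≤ 1)
    (hstep : ∀ c d : ℝ≥0∞, c + d = 1 → P c → P (c + ENNReal.ofReal k * d))
    (a b : ℝ≥0∞) (hP : ∀ c, P c → c * a ≤ b) : a ≤ b := by
  have h1 : Tendsto (fun n : ℕ => ENNReal.ofReal (1 - (1 - k) ^ n) * a) atTop (𝓝 (1 * a)) :=
    ENNReal.Tendsto.mul_const (aux_iter_lim k hk0 hk1) (Or.inl one_ne_zero)
  rw [one_mul] at h1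
  exact le_of_tendsto' h1 fun n => hP _ (aux_iter P h0 k hk0 hk1 hstep n)

/-- common arithmetic: `κ = em²/ep²`. -/
lemma aux_kappa (εm εp : ℝ) (hεm : 0 < εm) (hεmp : εm ≤ εp) (a b : ℝ≥0∞)
    (hab : ENNReal.ofReal εm * ENNReal.ofReal εm * a
      ≤ ENNReal.ofReal εp * ENNReal.ofReal εp * b) :
    ENNReal.ofReal (εm * εm / (εp * εp)) * a ≤ b := by
  have hp : 0 < εp := by linarith
  rw [← ENNReal.ofReal_mul hεm.le, ← ENNReal.ofReal_mul hp.le] at hab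
  have h0 : ENNReal.ofReal (εp * εp) ≠ 0 := by
    simp only [ne_eq, ENNReal.ofReal_eq_zero, not_le]; positivity
  rw [← ENNReal.mul_le_mul_iff_right h0 ENNReal.ofReal_ne_top, ← mul_assoc,
    ← ENNReal.ofReal_mul (by positivity)]
  rwa [mul_div_cancel₀ _ (by positivity)]

lemma aux_kappa_le (εm εp : ℝ) (hεm : 0 < εm) (hεmp : εm ≤ εp) :
    0 < εm * εm / (εp * εp) ∧ εm * εm / (εp * εp) ≤ 1 := by
  have hp : 0 < εp := by linarith
  refine ⟨by positivity, ?_⟩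
  rw [div_le_one (by positivity)]
  exact mul_le_mul hεmp hεmp hεm.le hp.le

lemma aux_unique_h {S : Type*} (z : S → S) (M : S → F → Measure F) (w : S → F → ℝ≥0∞)
    (εm εp : ℝ) (hεm : 0 < εm) (hεmp : εm ≤ εp) (ν : Measure F)
    (hM1 : ∀ s x, ENNReal.ofReal εm • ν ≤ M s x) (hM2 : ∀ s x, M s x ≤ ENNReal.ofReal εp • ν)
    (η : S → Measure F)
    (hη1 : ∀ s, ENNReal.ofReal εm • ν ≤ η s) (hη2 : ∀ s, η s ≤ ENNReal.ofReal εp • ν)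
    (L : S → ℝ≥0∞) (hL0 : ∀ s, L s ≠ 0) (hLt : ∀ s, L s ≠ ∞)
    (H H' : S → F → ℝ≥0∞) (hHm : ∀ s, Measurable (H s))
    (hHf : ∀ s x, H s x ≠ ∞)
    (hH : ∀ s x, w s x * ∫⁻ y, H (z s) y ∂(M s x) = L s * H s x)
    (hH' : ∀ s x, w s x * ∫⁻ y, H' (z s) y ∂(M s x) = L s * H' s x)
    (hη : ∀ s, ∫⁻ y, H s y ∂(η s) = 1) (hη' : ∀ s, ∫⁻ y, H' s y ∂(η s) = 1) :
    H' = H := by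
  set em := ENNReal.ofReal εm with hem
  set ep := ENNReal.ofReal εp with hep
  -- residual facts
  have hres : ∀ c : ℝ≥0∞, c ≠ ∞ → (∀ s x, c * H s x ≤ H' s x) → ∀ s x,
      w s x * ∫⁻ y, (H' (z s) y - c * H (z s) y) ∂(M s x) = L s * (H' s x - c * H s x) := by
    intro c hc hcH s x
    have e1 : ∫⁻ y, H' (z s) y ∂(M s x) = ∫⁻ y, (H' (z s) y - c * H (z s) y) ∂(M s x)
        + c * ∫⁻ y, H (z s) y ∂(M s x) := by
      rw [← lintegral_const_mul _ (hHm _), ← lintegral_add_right _ ((hHm _).const_mul _)]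
      exact lintegral_congr fun y => (tsub_add_cancel_of_le (hcH _ y)).symm
    have e2 := hH' s x
    rw [e1, mul_add] at e2
    have e3 : w s x * (c * ∫⁻ y, H (z s) y ∂(M s x)) = L s * (c * H s x) := by
      rw [mul_left_comm, hH, mul_left_comm]
    rw [e3] at e2
    have hfin : L s * (c * H s x) ≠ ∞ :=
      ENNReal.mul_ne_top (hLt s) (ENNReal.mul_ne_top hc (hHf s x))
    have e4 : L s * H' s x = L s * (H' s x - c * H s x) + L s * (c * H s x) := by
      rw [← mul_add, tsub_add_cancel_of_le (hcH s x)]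
    rw [e4] at e2
    exact (ENNReal.add_left_inj hfin).1 e2
  have hres2 : ∀ c d : ℝ≥0∞, c + d = 1 → (∀ s x, c * H s x ≤ H' s x) → ∀ s,
      ∫⁻ y, (H' s y - c * H s y) ∂(η s) = d := by
    intro c d hcd hcH s
    have hc : c ≠ ∞ := fun h => by simp [h] at hcd
    have e1 : ∫⁻ y, H' s y ∂(η s) = c * ∫⁻ y, H s y ∂(η s)
         + ∫⁻ y, (H' s y - c * H s y) ∂(η s) := by
      rw [← lintegral_const_mul _ (hHm _), ← lintegral_add_left ((hHm _).const_mul _)]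
      exact lintegral_congr fun y => (add_tsub_cancel_of_le (hcH _ y)).symm
    rw [hη, hη', mul_one, ← hcd] at e1
    exact ((ENNReal.add_right_inj hc).1 e1).symm
  have hνH : ∀ s, em * ∫⁻ y, H s y ∂ν ≤ 1 := by
    intro s
    rw [← hη s, ← smul_eq_mul, ← lintegral_smul_measure]
    exact lintegral_mono' (hη1 s) le_rfl
  obtain ⟨hk0, hk1⟩ := aux_kappa_le εm εp hεm hεmp
  have hle : ∀ s x, H s x ≤ H' s x := by
    intro s x
    refine aux_le_of_iter (fun c => ∀ s x, c * H s x ≤ H' s x) (by simp)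
      (εm * εm / (εp * εp)) hk0 hk1 ?_ _ _ (fun c hc => hc s x)
    intro c d hcd hc s x
    have hct : c ≠ ∞ := fun h => by simp [h] at hcd
    have r1 := hres c hct hc s x
    have r2 := hres2 c d hcd hc (z s)
    set r := fun y => H' (z s) y - c * H (z s) y with hr
    have a1 : em * ∫⁻ y, r y ∂ν ≤ ∫⁻ y, r y ∂(M s x) := by
      rw [← smul_eq_mul, ← lintegral_smul_measure]
      exact lintegral_mono' (hM1 s x) le_rfl
    have a2 : d ≤ ep * ∫⁻ y, r y ∂ν := by
      rw [← r2, ← smul_eq_mul, ← lintegral_smul_measure]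
      exact lintegral_mono' (hη2 _) le_rfl
    have a3 : ∫⁻ y, H (z s) y ∂(M s x) ≤ ep * ∫⁻ y, H (z s) y ∂ν := by
      rw [← smul_eq_mul, ← lintegral_smul_measure]
      exact lintegral_mono' (hM2 _ _) le_rfl
    have main : em * em * (d * H s x) ≤ ep * ep * (H' s x - c * H s x) := by
      rw [← ENNReal.mul_le_mul_iff_right (hL0 s) (hLt s)]
      calc L s * (em * em * (d * H s x)) = em * em * d * (L s * H s x) := by ring
        _ = em * em * d * (w s x * ∫⁻ y, H (z s) y ∂(M s x)) := by rw [hH]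
        _ ≤ em * em * d * (w s x * (ep * ∫⁻ y, H (z s) y ∂ν)) := by gcongr
        _ = em * d * w s x * ep * (em * ∫⁻ y, H (z s) y ∂ν) := by ring
        _ ≤ em * d * w s x * ep * 1 := by gcongr; exact hνH _
        _ ≤ em * (ep * ∫⁻ y, r y ∂ν) * w s x * ep * 1 := by gcongr
        _ = ep * ep * (w s x * (em * ∫⁻ y, r y ∂ν)) := by ring
        _ ≤ ep * ep * (w s x * ∫⁻ y, r y ∂(M s x)) := by gcongr
        _ = ep * ep * (L s * (H' s x - c * H s x)) := by rw [r1]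
        _ = _ := by ring
    have := aux_kappa εm εp hεm hεmp _ _ main
    rw [add_mul, mul_assoc]
    calc _ ≤ c * H s x + (H' s x - c * H s x) := by gcongr
      _ = _ := add_tsub_cancel_of_le (hc s x)
  funext s x
  refine le_antisymm ?_ (hle s x)
  have hc : ∀ s x, 1 * H s x ≤ H' s x := by simpa using hle
  have r1 := hres 1 (by simp) hc s x
  have r2 := hres2 1 0 (by simp) hc (z s)
  have b1 : em * ∫⁻ y, (H' (z s) y - 1 * H (z s) y) ∂ν ≤ 0 := by
    rw [← r2, ← smul_eq_mul, ← lintegral_smul_measure]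
    exact lintegral_mono' (hη1 _) le_rfl
  have b2 : ∫⁻ y, (H' (z s) y - 1 * H (z s) y) ∂ν = 0 := by
    rcases mul_eq_zero.1 (le_antisymm b1 bot_le) with h | h
    · exfalso; rw [hem, ENNReal.ofReal_eq_zero] at h; linarith
    · exact h
  have b3 : ∫⁻ y, (H' (z s) y - 1 * H (z s) y) ∂(M s x) ≤
      ep * ∫⁻ y, (H' (z s) y - 1 * H (z s) y) ∂ν := by
    rw [← smul_eq_mul, ← lintegral_smul_measure]
    exact lintegral_mono' (hM2 _ _) le_rfl
  rw [b2, mul_zero] at b3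
  rw [le_antisymm b3 bot_le, mul_zero] at r1
  rcases mul_eq_zero.1 r1.symm with h | h
  · exact absurd h (hL0 s)
  · rw [one_mul] at h; exact tsub_eq_zero_iff_le.1 h

lemma aux_unique_eta {S : Type*} (z : S → S) (hz : Function.Surjective z)
    (M : S → F → Measure F) (w : S → F → ℝ≥0∞)
    (hMm : ∀ s, Measurable (M s)) (hwm : ∀ s, Measurable (w s))
    (εm εp : ℝ) (hεm : 0 < εm) (hεmp : εm ≤ εp) (ν : Measure F)
    (hM1 : ∀ s x, ENNReal.ofReal εm • ν ≤ M s x) (hM2 : ∀ s x, M s x ≤ ENNReal.ofReal εp • ν)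
    (η θ : S → Measure F) [∀ s, IsFiniteMeasure (η s)]
    (hη1 : ∀ s, ENNReal.ofReal εm • ν ≤ η s) (hη2 : ∀ s, η s ≤ ENNReal.ofReal εp • ν)
    (L : S → ℝ≥0∞) (hL0 : ∀ s, L s ≠ 0) (hLt : ∀ s, L s ≠ ∞)
    (H : S → F → ℝ≥0∞) (hHm : ∀ s, Measurable (H s))
    (hHp : ∀ s x, H s x ≠ 0)
    (hH : ∀ s x, w s x * ∫⁻ y, H (z s) y ∂(M s x) = L s * H s x)
    (hηe : ∀ s A, MeasurableSet A → ∫⁻ x, w s x * M s x A ∂(η s) = L s * η (z s) A)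
    (hθe : ∀ s A, MeasurableSet A → ∫⁻ x, w s x * M s x A ∂(θ s) = L s * θ (z s) A)
    (hη : ∀ s, ∫⁻ y, H s y ∂(η s) = 1) (hθ : ∀ s, ∫⁻ y, H s y ∂(θ s) = 1) :
    ∀ s, θ s = η s := by
  set em := ENNReal.ofReal εm with hem
  set ep := ENNReal.ofReal εp with hep
  have hνH : ∀ s, em * ∫⁻ y, H s y ∂ν ≤ 1 := by
    intro s
    rw [← hη s, ← smul_eq_mul, ← lintegral_smul_measure]
    exact lintegral_mono' (hη1 s) le_rfl
  have hres : ∀ c d : ℝ≥0∞, c + d = 1 → (∀ s, c • η s ≤ θ s) → ∀ s, ∃ ρ : Measure F,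
      θ s = c • η s + ρ ∧ ∫⁻ y, H s y ∂ρ = d := by
    intro c d hcd hc s
    have hct : c ≠ ∞ := fun h => by simp [h] at hcd
    have : IsFiniteMeasure (c • η s) := Measure.smul_finite _ hct
    have e := Measure.sub_add_cancel_of_le (hc s)
    refine ⟨θ s - c • η s, by rw [add_comm, e], ?_⟩
    have e1 := hθ s
    rw [← e, lintegral_add_measure, lintegral_smul_measure, hη, smul_eq_mul, mul_one, ← hcd,
      add_comm] at e1
    exact (ENNReal.add_right_inj hct).1 e1
  obtain ⟨hk0, hk1⟩ := aux_kappa_le εm εp hεm hεmp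
  have hle : ∀ s, η s ≤ θ s := by
    intro s
    refine Measure.le_iff.2 fun A hA => ?_
    refine aux_le_of_iter (fun c => ∀ s, c • η s ≤ θ s) ?_
      (εm * εm / (εp * εp)) hk0 hk1 ?_ _ _ (fun c hc => ?_)
    · intro s; simp only [zero_smul]; exact Measure.zero_le _
    · intro c d hcd hc s'
      obtain ⟨s, rfl⟩ := hz s'
      refine Measure.le_iff.2 fun A hA => ?_
      obtain ⟨ρ, hρ, hρH⟩ := hres c d hcd hc s
      have hMA : Measurable fun x => M s x A := (Measure.measurable_coe hA).comp (hMm s)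
      have e1 := hθe s A hA
      rw [hρ, lintegral_add_measure, lintegral_smul_measure, hηe s A hA, smul_eq_mul] at e1
      have a1 : (∫⁻ x, w s x ∂ρ) * (em * ν A) ≤ ∫⁻ x, w s x * M s x A ∂ρ := by
        rw [← lintegral_mul_const _ (hwm s)]
        refine lintegral_mono fun x => ?_
        gcongr
        exact hM1 s x A
      have a2 : L s * d ≤ (∫⁻ x, w s x ∂ρ) * (ep * ∫⁻ y, H (z s) y ∂ν) := by
        rw [← hρH, ← lintegral_const_mul _ (hHm s), ← lintegral_mul_const _ (hwm s)]
        refine lintegral_mono fun x => ?_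
        simp only [← hH]
        gcongr
        rw [← smul_eq_mul, ← lintegral_smul_measure]
        exact lintegral_mono' (hM2 _ _) le_rfl
      have a3 : η (z s) A ≤ ep * ν A := hη2 (z s) A
      have main : em * em * (L s * (d * η (z s) A)) ≤
          ep * ep * ∫⁻ x, w s x * M s x A ∂ρ := by
        calc em * em * (L s * (d * η (z s) A)) = em * em * (L s * d) * η (z s) A := by ring
          _ ≤ em * em * ((∫⁻ x, w s x ∂ρ) * (ep * ∫⁻ y, H (z s) y ∂ν)) * (ep * ν A) := by
            gcongr
          _ = ep * ep * ((∫⁻ x, w s x ∂ρ) * (em * ν A)) * (em * ∫⁻ y, H (z s) y ∂ν) := by ring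
          _ ≤ ep * ep * (∫⁻ x, w s x * M s x A ∂ρ) * 1 := by gcongr; exact hνH _
          _ = _ := by ring
      have k1 := aux_kappa εm εp hεm hεmp _ _ main
      rw [← ENNReal.mul_le_mul_iff_right (hL0 s) (hLt s), ← e1]
      simp only [Measure.smul_apply, smul_eq_mul]
      calc L s * ((c + ENNReal.ofReal (εm * εm / (εp * εp)) * d) * η (z s) A)
          = c * (L s * η (z s) A) +
            ENNReal.ofReal (εm * εm / (εp * εp)) * (L s * (d * η (z s) A)) := by ring
        _ ≤ _ := by gcongr
    · have := hc s A
      simpa using this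
  intro s
  obtain ⟨ρ, hρ, hρH⟩ := hres 1 0 (by simp) (by simpa using hle) s
  rw [lintegral_eq_zero_iff (hHm s)] at hρH
  have : ρ = 0 := by
    rw [← Measure.measure_univ_eq_zero]
    have := measure_eq_zero_iff_ae_notMem.2
      (show ∀ᵐ a ∂ρ, a ∉ (Set.univ : Set F) from hρH.mono fun a ha => absurd ha (hHp s a))
    exact this
  rw [hρ, this]; simp

end Aux

section Aux2

lemma aux_shift_shiftInv {H : Type*} (ω : Env H) : shift (shiftInv ω) = ω := by
  funext n; simp [shift, shiftInv]

lemma aux_shiftInv_shift {H : Type*} (ω : Env H) : shiftInv (shift ω) = ω := by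
  funext n; simp [shift, shiftInv]

lemma aux_zit_shift {H : Type*} (n : ℕ) (ω : Env H) : zit n (shift ω) = shift (zit n ω) := by
  induction n with
  | zero => rfl
  | succ n ih => simp only [zit, ih]

lemma aux_zitInv_shift {H : Type*} (n : ℕ) (ω : Env H) :
    zitInv (n + 1) (shift ω) = zitInv n ω := by
  induction n with
  | zero => simp only [zitInv, aux_shiftInv_shift]
  | succ n ih => rw [zitInv, ih, zitInv]

lemma aux_zit_zitInv {H : Type*} (n : ℕ) (ω : Env H) : zit n (zitInv n ω) = ω := by
  induction n with
  | zero => rfl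
  | succ n ih => rw [zit, ← aux_zit_shift, zitInv, aux_shift_shiftInv, ih]

lemma aux_Qk_meas (M : Env H → E → Measure E) (W : Env H → E → ℝ)
    (hMmeas : Measurable fun p : Env H × E => M p.1 p.2)
    (hWmeas : Measurable fun p : Env H × E => W p.1 p.2) (ω : Env H) :
    Measurable (Qk M W ω) := by
  have h1 : Measurable (M ω) := hMmeas.comp measurable_prodMk_left
  have h2 : Measurable (W ω) := hWmeas.comp measurable_prodMk_left
  refine Measure.measurable_of_measurable_coe _ fun s hs => ?_
  simp only [Qk, Measure.smul_apply, smul_eq_mul]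
  exact h2.ennreal_ofReal.mul ((Measure.measurable_coe hs).comp h1)

lemma aux_Qn_meas (M : Env H → E → Measure E) (W : Env H → E → ℝ)
    (hQ : ∀ ω, Measurable (Qk M W ω)) (n : ℕ) (ω : Env H) :
    Measurable (Qn M W n ω) := by
  induction n with
  | zero => exact Measure.measurable_dirac
  | succ n ih => exact (Measure.measurable_bind' (hQ _)).comp ih

lemma aux_Qn_succ (M : Env H → E → Measure E) (W : Env H → E → ℝ)
    (hQ : ∀ ω, Measurable (Qk M W ω)) (n : ℕ) (ω : Env H) (x : E) :
    Qn M W (n + 1) ω x = (Qk M W ω x).bind (Qn M W n (shift ω)) := by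
  induction n with
  | zero =>
    change (Measure.dirac x).bind (Qk M W ω) = (Qk M W ω x).bind Measure.dirac
    rw [Measure.dirac_bind (hQ ω), Measure.bind_dirac]
  | succ n ih =>
    rw [Qn, ih, Measure.bind_bind (aux_Qn_meas M W hQ _ _).aemeasurable (hQ _).aemeasurable]
    simp only [zit, ← aux_zit_shift]
    rfl

lemma aux_lint_Qk (M : Env H → E → Measure E) (W : Env H → E → ℝ) (ω : Env H) (x : E)
    (f : E → ℝ≥0∞) :
    ∫⁻ y, f y ∂(Qk M W ω x) = ENNReal.ofReal (W ω x) * ∫⁻ y, f y ∂(M ω x) := by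
  rw [Qk, lintegral_smul_measure, smul_eq_mul]

end Aux2

/-- **Proposition 2, part 4 (uniqueness of the eigen-triple).** Assuming (B2), the
triple `(η,h,λ)` given by Proposition 2 satisfies the system
`η^ωQ^ω(·) = λ_ω η^{zω}(·)`, `Q^ω(h(zω,·))(x) = λ_ω h(ω,x)`, `η^ω(h(ω,·)) = 1`,
and it is the unique triple (probability measures, positive measurable function,
measurable function) that does so. -/
theorem proposition2_part4
    (M : Env H → E → Measure E) (W : Env H → E → ℝ)
    (hMprob : ∀ ω x, IsProbabilityMeasure (M ω x))
    (hMmeas : Measurable fun p : Env H × E => M p.1 p.2)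
    (hWmeas : Measurable fun p : Env H × E => W p.1 p.2)
    (hWnn : ∀ ω x, 0 ≤ W ω x) (CW : ℝ) (hWbdd : ∀ ω x, W ω x ≤ CW)
    -- (B2)
    (Δ1 : ℝ) (hΔ1 : 0 < Δ1)
    (hB2a : ∀ ω x u, ∫⁻ y, ENNReal.ofReal (W (shift ω) y) ∂(M ω x)
        ≤ ENNReal.ofReal Δ1 * ∫⁻ y, ENNReal.ofReal (W (shift ω) y) ∂(M ω u))
    (εm εp : ℝ) (hεm : 0 < εm) (hεmp : εm ≤ εp)
    (ν : Measure E) [IsProbabilityMeasure ν]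
    (hB2b : ∀ ω x, ∀ A : Set E, MeasurableSet A →
        ENNReal.ofReal εm * ν A ≤ M ω x A ∧ M ω x A ≤ ENNReal.ofReal εp * ν A)
    (Δ2 : ℝ) (hΔ2 : 0 < Δ2)
    (hB2c : ∀ n : ℕ, 1 ≤ n → ∀ ω, ∀ σ₁ σ₂ : Measure E,
        IsProbabilityMeasure σ₁ → IsProbabilityMeasure σ₂ →
        QnMass M W n ω σ₁ ≤ ENNReal.ofReal Δ2 * QnMass M W n ω σ₂)
    (hB2d : ∀ n : ℕ, 1 ≤ n → ∀ ω, ∀ σ : Measure E, IsProbabilityMeasure σ →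
        0 < QnMass M W n ω σ ∧ QnMass M W n ω σ < ∞)
    -- the triple (η, h, λ) given by Proposition 2, characterised by the limits
    (η : Env H → Measure E) (h : Env H → E → ℝ) (lam : Env H → ℝ)
    (hη : ∀ ω, IsProbabilityMeasure (η ω))
    (hηlim : ∀ σ : Measure E, IsProbabilityMeasure σ → ∀ ω, ∀ A : Set E,
      MeasurableSet A →
        Tendsto (fun n : ℕ => PhiSet M W n (zitInv n ω) σ A) atTop (𝓝 (η ω A)))
    (hhpos : ∀ ω x, 0 < h ω x)
    (hhmeas : Measurable (fun p : Env H × E => h p.1 p.2))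
    (hhlim : ∀ σ : Measure E, IsProbabilityMeasure σ → ∀ ω x,
        Tendsto (fun n : ℕ => (ratioH M W σ n ω x).toReal) atTop (𝓝 (h ω x)))
    (hlammeas : Measurable lam)
    (hlampos : ∀ ω, 0 < lam ω)
    (hlamdef : ∀ ω, lam ω = ∫ x, W ω x ∂(η ω)) :
    -- (η, h, λ) satisfies the system of equations
    ((∀ ω, ∀ A : Set E, MeasurableSet A →
        ((η ω).bind (Qk M W ω)) A = ENNReal.ofReal (lam ω) * η (shift ω) A) ∧
     (∀ ω x, ∫⁻ y, ENNReal.ofReal (h (shift ω) y) ∂(Qk M W ω x)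
        = ENNReal.ofReal (lam ω * h ω x)) ∧
     (∀ ω, ∫ x, h ω x ∂(η ω) = 1)) ∧
    -- and it is the unique such triple
    (∀ (η' : Env H → Measure E) (h' : Env H → E → ℝ) (lam' : Env H → ℝ),
      (∀ ω, IsProbabilityMeasure (η' ω)) →
      (∀ ω x, 0 < h' ω x) →
      Measurable (fun p : Env H × E => h' p.1 p.2) →
      Measurable lam' →
      (∀ ω, ∀ A : Set E, MeasurableSet A →
        ((η' ω).bind (Qk M W ω)) A = ENNReal.ofReal (lam' ω) * η' (shift ω) A) →
      (∀ ω x, ∫⁻ y, ENNReal.ofReal (h' (shift ω) y) ∂(Qk M W ω x)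
        = ENNReal.ofReal (lam' ω * h' ω x)) →
      (∀ ω, ∫ x, h' ω x ∂(η' ω) = 1) →
      (∀ ω, η' ω = η ω) ∧ h' = h ∧ lam' = lam) := by
  have hQ := aux_Qk_meas M W hMmeas hWmeas
  have hQn := aux_Qn_meas M W hQ
  have hWm : ∀ ω, Measurable (W ω) := fun ω => hWmeas.comp measurable_prodMk_left
  have hMm : ∀ ω, Measurable (M ω) := fun ω => hMmeas.comp measurable_prodMk_left
  have hhm : ∀ ω, Measurable (h ω) := fun ω => hhmeas.comp measurable_prodMk_left
  have hM1 : ∀ ω x, ENNReal.ofReal εm • ν ≤ M ω x := fun ω x =>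
    Measure.le_iff.2 fun A hA => by simpa using (hB2b ω x A hA).1
  have hM2 : ∀ ω x, M ω x ≤ ENNReal.ofReal εp • ν := fun ω x =>
    Measure.le_iff.2 fun A hA => by simpa using (hB2b ω x A hA).2
  have hQA : ∀ ω x A, Qk M W ω x A = ENNReal.ofReal (W ω x) * M ω x A := fun ω x A => by
    simp [Qk]
  have hQu : ∀ ω x, Qk M W ω x Set.univ = ENNReal.ofReal (W ω x) := fun ω x => by
    have := hMprob ω x
    simp [Qk]
  set q : ℕ → Env H → E → ℝ≥0∞ := fun n ω x => Qn M W n ω x Set.univ with hq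
  have hqm : ∀ n ω, Measurable (q n ω) := fun n ω =>
    (Measure.measurable_coe MeasurableSet.univ).comp (hQn n ω)
  have hqmass : ∀ n ω x, QnMass M W n ω (Measure.dirac x) = q n ω x := fun n ω x => by
    rw [QnMass, Measure.dirac_bind (hQn n ω)]
  have hqsucc : ∀ n ω x, q (n + 1) ω x = ∫⁻ y, q n (shift ω) y ∂(Qk M W ω x) := fun n ω x => by
    simp only [hq]
    rw [aux_Qn_succ M W hQ, Measure.bind_apply MeasurableSet.univ (hQn _ _).aemeasurable]
  -- the normalised measures
  set μ : ℕ → Env H → Measure E := fun n ω =>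
    (QnMass M W (n + 1) (zitInv (n + 1) ω) ν)⁻¹ • ν.bind (Qn M W (n + 1) (zitInv (n + 1) ω)) with hμ
  have hmass : ∀ n ω, QnMass M W (n + 1) ω ν ≠ 0 ∧ QnMass M W (n + 1) ω ν ≠ ∞ := fun n ω =>
    ⟨(hB2d (n + 1) (by omega) ω ν inferInstance).1.ne', (hB2d (n + 1) (by omega) ω ν inferInstance).2.ne⟩
  have hμ1 : ∀ n ω, μ n ω Set.univ = 1 := fun n ω => by
    simp only [hμ, Measure.smul_apply, smul_eq_mul]
    exact ENNReal.inv_mul_cancel (hmass _ _).1 (hmass _ _).2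
  have hμlim : ∀ ω A, MeasurableSet A → Tendsto (fun n => μ n ω A) atTop (𝓝 (η ω A)) := by
    intro ω A hA
    have := (tendsto_add_atTop_iff_nat 1).2 (hηlim ν inferInstance ω A hA)
    refine this.congr fun n => ?_
    simp only [hμ, PhiSet, Measure.smul_apply, smul_eq_mul, div_eq_mul_inv]
    rw [mul_comm]
  have hμrec : ∀ n ω A, MeasurableSet A →
      μ (n + 1) (shift ω) A * ∫⁻ x, ENNReal.ofReal (W ω x) ∂(μ n ω)
        = ∫⁻ x, Qk M W ω x A ∂(μ n ω) := by
    intro n ω A hA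
    have hz : zitInv (n + 2) (shift ω) = zitInv (n + 1) ω := aux_zitInv_shift (n + 1) ω
    have hb : ∀ B, MeasurableSet B → ν.bind (Qn M W (n + 2) (zitInv (n + 1) ω)) B
        = ∫⁻ x, Qk M W ω x B ∂(ν.bind (Qn M W (n + 1) (zitInv (n + 1) ω))) := by
      intro B hB
      have e : ν.bind (Qn M W (n + 2) (zitInv (n + 1) ω)) =
          (ν.bind (Qn M W (n + 1) (zitInv (n + 1) ω))).bind (Qk M W ω) := by
        rw [Measure.bind_bind (hQn _ _).aemeasurable (hQ _).aemeasurable]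
        congr 1
        funext x
        rw [Qn, aux_zit_zitInv]
      rw [e, Measure.bind_apply hB (hQ _).aemeasurable]
    have hm : QnMass M W (n + 2) (zitInv (n + 1) ω) ν
        = ∫⁻ x, ENNReal.ofReal (W ω x) ∂(ν.bind (Qn M W (n + 1) (zitInv (n + 1) ω))) := by
      rw [QnMass, hb _ MeasurableSet.univ]
      simp only [hQu]
    simp only [hμ, lintegral_smul_measure, smul_eq_mul, Measure.smul_apply]
    rw [show n + 1 + 1 = n + 2 from rfl, hz, hb A hA, ← hm]
    have := hmass (n + 1) (zitInv (n + 1) ω)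
    rw [show n + 1 + 1 = n + 2 from rfl] at this
    generalize QnMass M W (n + 2) (zitInv (n + 1) ω) ν = m at this ⊢
    generalize (QnMass M W (n + 1) (zitInv (n + 1) ω) ν)⁻¹ = m2
    calc _ = (m⁻¹ * m) * (m2 * ∫⁻ x, Qk M W ω x A ∂(ν.bind (Qn M W (n + 1) (zitInv (n + 1) ω)))) := by ring
      _ = _ := by rw [ENNReal.inv_mul_cancel this.1 this.2, one_mul]
  have hset : ∀ ω (f : E → ℝ), Measurable f → (∀ x, 0 ≤ f x) → ∀ C, (∀ x, f x ≤ C) →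
      Tendsto (fun n => ∫⁻ x, ENNReal.ofReal (f x) ∂(μ n ω)) atTop
      (𝓝 (∫⁻ x, ENNReal.ofReal (f x) ∂(η ω))) := fun ω f hf h0 C hC =>
    aux_setwise (fun n => μ n ω) (η ω) (fun n => (hμ1 n ω).le) (hμlim ω) f hf h0 C hC
  set L : Env H → ℝ≥0∞ := fun ω => ENNReal.ofReal (lam ω) with hL
  have hLW : ∀ ω, L ω = ∫⁻ x, ENNReal.ofReal (W ω x) ∂(η ω) := by
    intro ω
    simp only [hL]
    rw [hlamdef, ofReal_integral_eq_lintegral_ofReal _ (Eventually.of_forall (hWnn ω))]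
    have := hη ω
    exact Integrable.of_bound (hWm ω).aestronglyMeasurable CW (Eventually.of_forall fun x => by
      rw [Real.norm_of_nonneg (hWnn ω x)]; exact hWbdd ω x)
  have hL0 : ∀ ω, L ω ≠ 0 := fun ω => by simp [hL, hlampos ω]
  have hLt : ∀ ω, L ω ≠ ∞ := fun ω => ENNReal.ofReal_ne_top
  have hηe : ∀ ω A, MeasurableSet A → ∫⁻ x, Qk M W ω x A ∂(η ω) = L ω * η (shift ω) A := by
    intro ω A hA
    have := hη (shift ω)
    have t1 : Tendsto (fun n => μ (n + 1) (shift ω) A) atTop (𝓝 (η (shift ω) A)) :=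
      (tendsto_add_atTop_iff_nat 1).2 (hμlim (shift ω) A hA)
    have t2 := hset ω (W ω) (hWm ω) (hWnn ω) CW (hWbdd ω)
    rw [← hLW] at t2
    have t3 := ENNReal.Tendsto.mul t1 (Or.inr (hLt ω)) t2 (Or.inr (measure_ne_top _ _))
    simp_rw [hμrec _ ω A hA] at t3
    have e : ∀ x, Qk M W ω x A = ENNReal.ofReal (W ω x * (M ω x A).toReal) := fun x => by
      have := hMprob ω x
      rw [hQA, ENNReal.ofReal_mul (hWnn ω x), ENNReal.ofReal_toReal (measure_ne_top _ _)]
    have t4 := hset ω (fun x => W ω x * (M ω x A).toReal)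
      ((hWm ω).mul ((Measure.measurable_coe hA).comp (hMm ω)).ennreal_toReal)
      (fun x => mul_nonneg (hWnn ω x) ENNReal.toReal_nonneg) CW (fun x => by
        have := hMprob ω x
        have h1 : (M ω x A).toReal ≤ 1 := by
          have := ENNReal.toReal_mono ENNReal.one_ne_top (prob_le_one (μ := M ω x) (s := A))
          simpa using this
        calc W ω x * (M ω x A).toReal ≤ W ω x * 1 := mul_le_mul_of_nonneg_left h1 (hWnn ω x)
          _ ≤ CW := by simpa using hWbdd ω x)
    simp_rw [← e] at t4
    rw [tendsto_nhds_unique t4 t3, mul_comm]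
  have hηb : ∀ ω, (η ω).bind (Qk M W ω) = L ω • η (shift ω) := fun ω => by
    ext A hA
    rw [Measure.bind_apply hA (hQ _).aemeasurable, hηe ω A hA]; simp
  have hη1 : ∀ ω, ENNReal.ofReal εm • ν ≤ η ω := by
    intro ω'
    obtain ⟨ω, rfl⟩ : ∃ ω, shift ω = ω' := ⟨_, aux_shift_shiftInv ω'⟩
    refine Measure.le_iff.2 fun A hA => ?_
    rw [← ENNReal.mul_le_mul_iff_right (hL0 ω) (hLt ω), ← hηe ω A hA, hLW,
      ← lintegral_mul_const _ (hWm ω).ennreal_ofReal]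
    refine lintegral_mono fun x => ?_
    simp only [hQA]
    gcongr
    exact hM1 ω x
  have hη2 : ∀ ω, η ω ≤ ENNReal.ofReal εp • ν := by
    intro ω'
    obtain ⟨ω, rfl⟩ : ∃ ω, shift ω = ω' := ⟨_, aux_shift_shiftInv ω'⟩
    refine Measure.le_iff.2 fun A hA => ?_
    rw [← ENNReal.mul_le_mul_iff_right (hL0 ω) (hLt ω), ← hηe ω A hA, hLW,
      ← lintegral_mul_const _ (hWm ω).ennreal_ofReal]
    refine lintegral_mono fun x => ?_
    simp only [hQA]
    gcongr
    exact hM2 ω x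
  have hμ2 : ∀ n ω, μ (n + 1) ω ≤ ENNReal.ofReal εp • ν := by
    intro n ω'
    obtain ⟨ω, rfl⟩ : ∃ ω, shift ω = ω' := ⟨_, aux_shift_shiftInv ω'⟩
    refine Measure.le_iff.2 fun A hA => ?_
    have e0 := hμrec n ω A hA
    have e1 := hμrec n ω _ MeasurableSet.univ
    set m := ∫⁻ x, ENNReal.ofReal (W ω x) ∂(μ n ω) with hm
    have hmt : m ≠ ∞ := by
      have : m ≤ ∫⁻ x, ENNReal.ofReal CW ∂(μ n ω) :=
        lintegral_mono fun x => ENNReal.ofReal_le_ofReal (hWbdd ω x)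
      rw [lintegral_const, hμ1, mul_one] at this
      exact ne_top_of_le_ne_top ENNReal.ofReal_ne_top this
    have hm0 : m ≠ 0 := by
      intro h0
      have hm' : QnMass M W (n + 2) (zitInv (n + 2) (shift ω)) ν = 0 := by
        rw [QnMass, aux_zitInv_shift (n + 1) ω]
        have e : ν.bind (Qn M W (n + 2) (zitInv (n + 1) ω)) =
            (ν.bind (Qn M W (n + 1) (zitInv (n + 1) ω))).bind (Qk M W ω) := by
          rw [Measure.bind_bind (hQn _ _).aemeasurable (hQ _).aemeasurable]
          congr 1
          funext x
          rw [Qn, aux_zit_zitInv]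
        rw [e, Measure.bind_apply MeasurableSet.univ (hQ _).aemeasurable]
        simp only [hQu]
        rw [hm] at h0
        simp only [hμ, lintegral_smul_measure, smul_eq_mul] at h0
        rcases mul_eq_zero.1 h0 with h | h
        · exact absurd (ENNReal.inv_eq_zero.1 h) (hmass _ _).2
        · exact h
      exact (hmass (n + 1) _).1 hm'
    rw [← ENNReal.mul_le_mul_iff_left hm0 hmt, e0, hm, mul_comm,
      ← lintegral_mul_const _ (hWm ω).ennreal_ofReal]
    refine lintegral_mono fun x => ?_
    simp only [hQA]
    gcongr
    exact hM2 ω x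
  -- the ratios
  set D : ℕ → Env H → ℝ≥0∞ := fun n ω => ∫⁻ y, q (n + 1) ω y ∂(μ n ω) with hD
  set R : ℕ → Env H → E → ℝ≥0∞ := fun n ω x => q (n + 1) ω x * (D n ω)⁻¹ with hR
  have hRr : ∀ n ω x, ratioH M W ν (n + 1) ω x = R n ω x := by
    intro n ω x
    simp only [hR, hD, ratioH, PhiFun, hμ, lintegral_smul_measure, smul_eq_mul, div_eq_mul_inv, hq]
    rw [mul_comm (∫⁻ _, _ ∂_)]
  have hqle : ∀ n ω x y, q (n + 1) ω x ≤ ENNReal.ofReal Δ2 * q (n + 1) ω y := by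
    intro n ω x y
    rw [← hqmass, ← hqmass]
    exact hB2c _ (by omega) ω _ _ inferInstance inferInstance
  have hq0 : ∀ n ω x, q (n + 1) ω x ≠ 0 ∧ q (n + 1) ω x ≠ ∞ := by
    intro n ω x
    rw [← hqmass]
    have := hB2d (n + 1) (by omega) ω (Measure.dirac x) inferInstance
    exact ⟨this.1.ne', this.2.ne⟩
  have hqD : ∀ n ω x, q (n + 1) ω x ≤ ENNReal.ofReal Δ2 * D n ω := by
    intro n ω x
    simp only [hD]
    rw [← lintegral_const_mul _ (hqm _ _)]
    calc q (n + 1) ω x = ∫⁻ y, q (n + 1) ω x ∂(μ n ω) := by rw [lintegral_const, hμ1, mul_one]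
      _ ≤ _ := lintegral_mono fun y => hqle n ω x y
  obtain ⟨x0⟩ : Nonempty E := ν.nonempty_of_neZero
  have hD0 : ∀ n ω, D n ω ≠ 0 := by
    intro n ω h0
    have := hqD n ω x0
    rw [h0, mul_zero] at this
    exact (hq0 n ω x0).1 (le_antisymm this bot_le)
  have hDt : ∀ n ω, D n ω ≠ ∞ := by
    intro n ω
    have : D n ω ≤ ∫⁻ y, ENNReal.ofReal Δ2 * q (n + 1) ω x0 ∂(μ n ω) :=
      lintegral_mono fun y => hqle n ω y x0
    rw [lintegral_const, hμ1, mul_one] at this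
    exact ne_top_of_le_ne_top (ENNReal.mul_ne_top ENNReal.ofReal_ne_top (hq0 n ω x0).2) this
  have hRle : ∀ n ω x, R n ω x ≤ ENNReal.ofReal Δ2 := by
    intro n ω x
    simp only [hR]
    rw [← div_eq_mul_inv]
    exact ENNReal.div_le_of_le_mul (hqD n ω x)
  have hRm : ∀ n ω, Measurable (R n ω) := fun n ω => (hqm _ _).mul_const _
  set Hh : Env H → E → ℝ≥0∞ := fun ω x => ENNReal.ofReal (h ω x) with hHh
  have hHm : ∀ ω, Measurable (Hh ω) := fun ω => (hhm ω).ennreal_ofReal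
  have hRlim : ∀ ω x, Tendsto (fun n => R n ω x) atTop (𝓝 (Hh ω x)) := by
    intro ω x
    have := ENNReal.tendsto_ofReal
      ((tendsto_add_atTop_iff_nat 1).2 (hhlim ν inferInstance ω x))
    refine this.congr fun n => ?_
    rw [hRr, ENNReal.ofReal_toReal (ne_top_of_le_ne_top ENNReal.ofReal_ne_top (hRle n ω x))]
  have hHle : ∀ ω x, Hh ω x ≤ ENNReal.ofReal Δ2 := fun ω x =>
    le_of_tendsto' (hRlim ω x) fun n => hRle n ω x
  have hhle : ∀ ω x, h ω x ≤ Δ2 := fun ω x =>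
    (ENNReal.ofReal_le_ofReal_iff hΔ2.le).1 (hHle ω x)
  have hHt : ∀ ω x, Hh ω x ≠ ∞ := fun ω x => ENNReal.ofReal_ne_top
  have hHp : ∀ ω x, Hh ω x ≠ 0 := fun ω x => by simp [hHh, hhpos ω x]
  have hμR : ∀ n ω, ∫⁻ x, R n ω x ∂(μ n ω) = 1 := by
    intro n ω
    simp only [hR]
    rw [lintegral_mul_const _ (hqm _ _)]
    exact ENNReal.mul_inv_cancel (hD0 n ω) (hDt n ω)
  have hηH : ∀ ω, ∫⁻ x, Hh ω x ∂(η ω) = 1 := by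
    intro ω
    have t0 : Tendsto (fun n => ∫⁻ x, Hh ω x ∂(μ (n + 1) ω)) atTop (𝓝 (∫⁻ x, Hh ω x ∂(η ω))) :=
      (tendsto_add_atTop_iff_nat 1).2
        (hset ω (h ω) (hhm ω) (fun x => (hhpos ω x).le) Δ2 (hhle ω))
    have ha : Tendsto (fun n => ENNReal.ofReal εp * ∫⁻ x, (R (n + 1) ω x - Hh ω x) ∂ν)
        atTop (𝓝 0) := by
      have t : Tendsto (fun n => ∫⁻ x, (R (n + 1) ω x - Hh ω x) ∂ν) atTop (𝓝 (∫⁻ x, 0 ∂ν)) := by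
        refine tendsto_lintegral_of_dominated_convergence (fun _ => ENNReal.ofReal Δ2)
          (fun n => (hRm _ _).sub (hHm _))
          (fun n => Eventually.of_forall fun x => tsub_le_self.trans (hRle _ _ _)) (by simp)
          (Eventually.of_forall fun x => ?_)
        have := ENNReal.Tendsto.sub ((tendsto_add_atTop_iff_nat 1).2 (hRlim ω x))
          (tendsto_const_nhds (x := Hh ω x)) (Or.inl (hHt ω x))
        rwa [tsub_self] at this
      have := ENNReal.Tendsto.const_mul (a := ENNReal.ofReal εp) t (Or.inr ENNReal.ofReal_ne_top)
      simpa using this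
    have hb : Tendsto (fun n => ENNReal.ofReal εp * ∫⁻ x, (Hh ω x - R (n + 1) ω x) ∂ν)
        atTop (𝓝 0) := by
      have t : Tendsto (fun n => ∫⁻ x, (Hh ω x - R (n + 1) ω x) ∂ν) atTop (𝓝 (∫⁻ x, 0 ∂ν)) := by
        refine tendsto_lintegral_of_dominated_convergence (fun _ => ENNReal.ofReal Δ2)
          (fun n => (hHm _).sub (hRm _ _))
          (fun n => Eventually.of_forall fun x => tsub_le_self.trans (hHle _ _)) (by simp)
          (Eventually.of_forall fun x => ?_)
        have := ENNReal.Tendsto.sub (tendsto_const_nhds (x := Hh ω x))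
          ((tendsto_add_atTop_iff_nat 1).2 (hRlim ω x)) (Or.inl (hHt ω x))
        rwa [tsub_self] at this
      have := ENNReal.Tendsto.const_mul (a := ENNReal.ofReal εp) t (Or.inr ENNReal.ofReal_ne_top)
      simpa using this
    have hgen : ∀ n (f g : E → ℝ≥0∞), Measurable f → Measurable g →
        ∫⁻ x, f x ∂(μ (n + 1) ω) ≤ ∫⁻ x, g x ∂(μ (n + 1) ω) +
          ENNReal.ofReal εp * ∫⁻ x, (f x - g x) ∂ν := by
      intro n f g hf hg
      calc ∫⁻ x, f x ∂(μ (n + 1) ω) ≤ ∫⁻ x, (g x + (f x - g x)) ∂(μ (n + 1) ω) :=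
            lintegral_mono fun x => le_add_tsub
        _ = ∫⁻ x, g x ∂(μ (n + 1) ω) + ∫⁻ x, (f x - g x) ∂(μ (n + 1) ω) :=
            lintegral_add_left hg _
        _ ≤ _ := by
            gcongr
            rw [← smul_eq_mul, ← lintegral_smul_measure]
            exact lintegral_mono' (hμ2 n ω) le_rfl
    apply le_antisymm
    · have t1 := (tendsto_const_nhds (x := (1:ℝ≥0∞))).add hb
      rw [add_zero] at t1
      refine le_of_tendsto_of_tendsto' t0 t1 fun n => ?_
      have := hgen n (Hh ω) (R (n + 1) ω) (hHm _) (hRm _ _)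
      rwa [hμR] at this
    · have t1 := t0.add ha
      rw [add_zero] at t1
      refine ge_of_tendsto' t1 fun n => ?_
      have := hgen n (R (n + 1) ω) (Hh ω) (hRm _ _) (hHm _)
      rwa [hμR] at this
  have hdom : ∀ ω (m : Measure E), IsFiniteMeasure m →
      Tendsto (fun n => ∫⁻ x, R n ω x ∂m) atTop (𝓝 (∫⁻ x, Hh ω x ∂m)) := by
    intro ω m _
    refine tendsto_lintegral_of_dominated_convergence (fun _ => ENNReal.ofReal Δ2)
          (fun n => hRm _ _)
          (fun n => Eventually.of_forall fun x => hRle _ _ _) ?_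
          (Eventually.of_forall fun x => hRlim ω x)
    rw [lintegral_const]
    exact ENNReal.mul_ne_top ENNReal.ofReal_ne_top (measure_ne_top _ _)
  have hηR : ∀ ω, Tendsto (fun n => ∫⁻ x, R n ω x ∂(η ω)) atTop (𝓝 1) := by
    intro ω
    have := hη ω
    rw [← hηH ω]
    exact hdom ω (η ω) inferInstance
  have hHeig : ∀ ω x, ∫⁻ y, Hh (shift ω) y ∂(Qk M W ω x) = L ω * Hh ω x := by
    intro ω x
    have : IsFiniteMeasure (Qk M W ω x) := ⟨by rw [hQu]; exact ENNReal.ofReal_lt_top⟩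
    have t1 := hdom (shift ω) (Qk M W ω x) inferInstance
    have t2 : Tendsto (fun n => ∫⁻ x, R (n + 1) ω x ∂(η ω)) atTop (𝓝 1) :=
      (tendsto_add_atTop_iff_nat 1).2 (hηR ω)
    have hfin : ∫⁻ y, Hh (shift ω) y ∂(Qk M W ω x) ≠ ∞ := by
      have : ∫⁻ y, Hh (shift ω) y ∂(Qk M W ω x) ≤ ∫⁻ y, ENNReal.ofReal Δ2 ∂(Qk M W ω x) :=
        lintegral_mono fun y => hHle _ _
      rw [lintegral_const] at this
      exact ne_top_of_le_ne_top
        (ENNReal.mul_ne_top ENNReal.ofReal_ne_top (measure_ne_top _ _)) this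
    have t3 := ENNReal.Tendsto.mul t1 (Or.inr ENNReal.one_ne_top) t2 (Or.inr hfin)
    have t4 : Tendsto (fun n => R (n + 1) ω x) atTop (𝓝 (Hh ω x)) :=
      (tendsto_add_atTop_iff_nat 1).2 (hRlim ω x)
    have t5 := ENNReal.Tendsto.const_mul (a := L ω) (hηR (shift ω)) (Or.inr (hLt ω))
    rw [mul_one] at t5
    have t6 := ENNReal.Tendsto.mul t4 (Or.inr (hLt ω)) t5 (Or.inr (hHt ω x))
    have hQR : ∀ n x, ∫⁻ y, R n (shift ω) y ∂(Qk M W ω x)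
        = q (n + 2) ω x * (D n (shift ω))⁻¹ := by
      intro n x
      simp only [hR]
      rw [lintegral_mul_const _ (hqm _ _), ← hqsucc]
    have e : ∀ n, (∫⁻ y, R n (shift ω) y ∂(Qk M W ω x)) * ∫⁻ x, R (n + 1) ω x ∂(η ω)
        = R (n + 1) ω x * (L ω * ∫⁻ x, R n (shift ω) x ∂(η (shift ω))) := by
      intro n
      have e1 : L ω * ∫⁻ x, R n (shift ω) x ∂(η (shift ω))
          = (∫⁻ x, q (n + 2) ω x ∂(η ω)) * (D n (shift ω))⁻¹ := by
        rw [← smul_eq_mul (L ω), ← lintegral_smul_measure, ← hηb,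
          Measure.lintegral_bind (hQ _).aemeasurable (hRm _ _).aemeasurable]
        simp_rw [hQR]
        rw [lintegral_mul_const _ (hqm _ _)]
      rw [e1, hQR]
      simp only [hR]
      rw [lintegral_mul_const _ (hqm _ _)]
      ring
    simp_rw [e] at t3
    have := tendsto_nhds_unique t3 t6
    rw [mul_one] at this
    rw [this, mul_comm]
  refine ⟨⟨?_, ?_, ?_⟩, ?_⟩
  · intro ω A hA
    rw [hηb]; simp [hL]
  · intro ω x
    rw [ENNReal.ofReal_mul (hlampos ω).le]
    exact hHeig ω x
  · intro ω
    rw [integral_eq_lintegral_of_nonneg_ae (Eventually.of_forall fun x => (hhpos ω x).le)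
      (hhm ω).aestronglyMeasurable]
    have := hηH ω
    simp only [hHh] at this
    rw [this]; simp
  · intro η' h' lam' hη' hh'pos hh'meas hlam'meas he1 he2 he3
    have hh'm : ∀ ω, Measurable (h' ω) := fun ω => hh'meas.comp measurable_prodMk_left
    have hfeig : ∀ ω x, ENNReal.ofReal (W ω x) * ∫⁻ y, Hh (shift ω) y ∂(M ω x)
        = L ω * Hh ω x := fun ω x => by rw [← aux_lint_Qk, hHeig]
    set a : Env H → ℝ≥0∞ := fun ω => ∫⁻ x, Hh ω x ∂(η' ω) with ha
    have hat : ∀ ω, a ω ≠ ∞ := by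
      intro ω
      have := hη' ω
      have : a ω ≤ ∫⁻ y, ENNReal.ofReal Δ2 ∂(η' ω) := lintegral_mono fun y => hHle _ _
      rw [lintegral_const] at this
      exact ne_top_of_le_ne_top
        (ENNReal.mul_ne_top ENNReal.ofReal_ne_top (measure_ne_top _ _)) this
    have ha0 : ∀ ω, a ω ≠ 0 := by
      intro ω h0
      have := hη' ω
      simp only [ha] at h0
      rw [lintegral_eq_zero_iff (hHm ω)] at h0
      have h1 : ∀ᵐ x ∂(η' ω), False := h0.mono fun x hx => hHp ω x hx
      simp at h1
      exact NeZero.ne (η' ω) h1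
    have hη'b : ∀ ω, (η' ω).bind (Qk M W ω) = ENNReal.ofReal (lam' ω) • η' (shift ω) := fun ω => by
      ext A hA
      rw [he1 ω A hA]; simp
    have haL : ∀ ω, ENNReal.ofReal (lam' ω) * a (shift ω) = L ω * a ω := by
      intro ω
      simp only [ha]
      rw [← smul_eq_mul (ENNReal.ofReal _), ← lintegral_smul_measure, ← hη'b,
          Measure.lintegral_bind (hQ _).aemeasurable (hHm _).aemeasurable]
      simp_rw [hHeig]
      rw [lintegral_const_mul _ (hHm _)]
    have hsurj : Function.Surjective (shift : Env H → Env H) := fun ω => ⟨_, aux_shift_shiftInv ω⟩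
    have hθ := aux_unique_eta shift hsurj M (fun ω x => ENNReal.ofReal (W ω x)) hMm
      (fun ω => (hWm ω).ennreal_ofReal) εm εp hεm hεmp ν hM1 hM2 η (fun ω => (a ω)⁻¹ • η' ω)
      hη1 hη2 L hL0 hLt Hh hHm hHp hfeig
      (fun ω A hA => by simp_rw [← hQA]; exact hηe ω A hA)
      (fun ω A hA => by
        simp_rw [← hQA]
        rw [lintegral_smul_measure, ← Measure.bind_apply hA (hQ _).aemeasurable, he1 ω A hA]
        simp only [Measure.smul_apply, smul_eq_mul]
        have := haL ω
        have e : (a ω)⁻¹ * ENNReal.ofReal (lam' ω) = L ω * (a (shift ω))⁻¹ := by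
          calc (a ω)⁻¹ * ENNReal.ofReal (lam' ω)
              = (a ω)⁻¹ * ENNReal.ofReal (lam' ω) * (a (shift ω) * (a (shift ω))⁻¹) := by
                rw [ENNReal.mul_inv_cancel (ha0 _) (hat _), mul_one]
            _ = (a ω)⁻¹ * (ENNReal.ofReal (lam' ω) * a (shift ω)) * (a (shift ω))⁻¹ := by ring
            _ = (a ω * (a ω)⁻¹) * (L ω * (a (shift ω))⁻¹) := by rw [haL]; ring
            _ = _ := by rw [ENNReal.mul_inv_cancel (ha0 _) (hat _), one_mul]
        rw [← mul_assoc, e, mul_assoc])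
      hηH
      (fun ω => by
        rw [lintegral_smul_measure, smul_eq_mul]
        exact ENNReal.inv_mul_cancel (ha0 ω) (hat ω))
    have hηη : ∀ ω, η' ω = η ω := by
      intro ω
      have e := hθ ω
      have := hη ω
      have := hη' ω
      have e1 : ((a ω)⁻¹ • η' ω) Set.univ = η ω Set.univ := by rw [e]
      simp only [Measure.smul_apply, measure_univ, smul_eq_mul, mul_one] at e1
      simp only [e1, one_smul] at e
      exact e
    have hlamL : ∀ ω, ENNReal.ofReal (lam' ω) = L ω := by
      intro ω
      have := haL ω
      have e : ∀ ω, a ω = 1 := fun ω => by simp only [ha]; rw [hηη, hηH]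
      rwa [e, e, mul_one, mul_one] at this
    have hlameq : ∀ ω, lam' ω = lam ω := by
      intro ω
      have e := hlamL ω
      simp only [hL] at e
      have hp : 0 < lam' ω := by
        rw [← ENNReal.ofReal_pos, e, ENNReal.ofReal_pos]; exact hlampos ω
      exact (ENNReal.ofReal_eq_ofReal_iff hp.le (hlampos ω).le).1 e
    have hfin := aux_unique_h shift M (fun ω x => ENNReal.ofReal (W ω x))
      εm εp hεm hεmp ν hM1 hM2 η hη1 hη2 L hL0 hLt Hh (fun ω x => ENNReal.ofReal (h' ω x))
      hHm hHt hfeig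
      (fun ω x => by
        rw [← aux_lint_Qk, he2, hlameq, ENNReal.ofReal_mul (hlampos ω).le])
      hηH
      (fun ω => by
        have e := he3 ω
        rw [hηη] at e
        have hi : Integrable (h' ω) (η ω) := by
          by_contra hc
          rw [integral_undef hc] at e
          exact zero_ne_one e
        rw [← ofReal_integral_eq_lintegral_ofReal hi
          (Eventually.of_forall fun x => (hh'pos ω x).le), e]
        simp)
    refine ⟨hηη, ?_, funext hlameq⟩
    funext ω x
    have e := congrFun (congrFun hfin ω) x
    exact (ENNReal.ofReal_eq_ofReal_iff (hh'pos ω x).le (hhpos ω x).le).1 e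

end
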